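/- Let D ≥ 3. A bilinear map α : m × m → m is rotation equivariant and carrollian-boost equivariant if and only if there exists ζ ∈ ℝ such that α((h,p),(h',p')) = (ζ ⟨p,p'⟩, 0) for all (h,p),(h',p') ∈ m, where ⟨·,·⟩ is the standard inner product on ℝ^D; that is, the invariant Nomizu maps of the (D+1)-dimensional carrollian homogeneous spacetimes form exactly the one-parameter family with α(P_a,P_b) = ζ δ_{ab} H and all other components zero. -/

import Mathlib

open Matrix

/-- The vector space `m = ℝ × ℝ^D`, with elements written `(h, p)`;
`H = (1, 0)` and `P a = (0, e a)`. -/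
abbrev Mspace (D : ℕ) : Type := ℝ × (Fin D → ℝ)

/-- The infinitesimal rotation `ρ_Λ (h, p) = (0, Λ p)` associated to a `D × D` matrix `Λ`. -/
noncomputable def rotMap {D : ℕ} (Λ : Matrix (Fin D) (Fin D) ℝ) :
    Mspace D →ₗ[ℝ] Mspace D :=
  LinearMap.prod 0 (Λ.mulVecLin ∘ₗ LinearMap.snd ℝ ℝ (Fin D → ℝ))

/-- The carrollian boost `β_a (h, p) = (p_a, 0)`. -/
noncomputable def carBoost {D : ℕ} (a : Fin D) : Mspace D →ₗ[ℝ] Mspace D :=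
  LinearMap.prod (LinearMap.proj a ∘ₗ LinearMap.snd ℝ ℝ (Fin D → ℝ)) 0

/-- A bilinear map `α : m × m → m` is equivariant under a linear endomorphism `X` of `m`
if `X (α Y Z) = α (X Y) Z + α Y (X Z)` for all `Y Z ∈ m`. -/
def IsEquivariant {D : ℕ} (X : Mspace D →ₗ[ℝ] Mspace D)
    (α : Mspace D →ₗ[ℝ] Mspace D →ₗ[ℝ] Mspace D) : Prop :=
  ∀ Y Z : Mspace D, X (α Y Z) = α (X Y) Z + α Y (X Z)

/-- The rotation generator in the `(i, j)` plane: it sends `P_j` to `P_i` and `P_i` to `-P_j`. -/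
noncomputable def planeRotation {D : ℕ} (i j : Fin D) : Matrix (Fin D) (Fin D) ℝ :=
  Matrix.single i j 1 - Matrix.single j i 1

lemma planeRotation_transpose {D : ℕ} (i j : Fin D) :
    (planeRotation i j)ᵀ = -planeRotation i j := by
  simp [planeRotation, Matrix.transpose_sub, Matrix.transpose_single]

lemma rotMap_planeRotation {D : ℕ} (i j : Fin D) (h : ℝ) (p : Fin D → ℝ) :
    rotMap (planeRotation i j) (h, p) = (0, Pi.single i (p j) - Pi.single j (p i)) := by
  simp [rotMap, planeRotation, Matrix.single_mulVec, Pi.single]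

lemma carBoost_apply {D : ℕ} (a : Fin D) (h : ℝ) (p : Fin D → ℝ) :
    carBoost a (h, p) = (p a, 0) := by
  simp [carBoost]

lemma rotMap_apply {D : ℕ} (Λ : Matrix (Fin D) (Fin D) ℝ) (v : Mspace D) :
    rotMap Λ v = (0, Λ *ᵥ v.2) := by
  simp [rotMap]

/-- Expansion of an element of `m` in the basis `H, P_a`. -/
lemma Mspace.eq_smul_add_sum {D : ℕ} (v : Mspace D) :
    v = v.1 • ((1, 0) : Mspace D) + ∑ a, v.2 a • ((0, Pi.single a 1) : Mspace D) := by
  ext i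
  · simp [Prod.fst_sum]
  · simp [Prod.snd_sum, Finset.sum_apply, Pi.single_apply]

/-- A bilinear map on `m` is determined by its values on the basis `H, P_a`. -/
lemma bilin_eq_of_basis {D : ℕ} (α : Mspace D →ₗ[ℝ] Mspace D →ₗ[ℝ] Mspace D) (ζ : ℝ)
    (hHH : α (1, 0) (1, 0) = 0)
    (hHP : ∀ b, α (1, 0) (0, Pi.single b 1) = 0)
    (hPH : ∀ b, α (0, Pi.single b 1) (1, 0) = 0)
    (hPP : ∀ b c, α (0, Pi.single b 1) (0, Pi.single c 1) = (if b = c then ζ else 0, 0))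
    (v w : Mspace D) : α v w = (ζ * (v.2 ⬝ᵥ w.2), 0) := by
  conv_lhs => rw [Mspace.eq_smul_add_sum v, Mspace.eq_smul_add_sum w]
  simp only [map_add, map_smul, map_sum, LinearMap.add_apply, LinearMap.smul_apply,
    LinearMap.sum_apply, hHH, hHP, hPH, hPP]
  ext i
  · simp [Prod.fst_sum, dotProduct, Finset.mul_sum]
    refine Finset.sum_congr rfl fun x _ => by ring
  · simp [Prod.snd_sum, Finset.sum_apply]

/-- For `D ≥ 3`, a bilinear map `α` on `m = ℝ × ℝ^D` is rotation equivariant and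
carrollian-boost equivariant if and only if there is `ζ : ℝ` with
`α((h,p),(h',p')) = (ζ ⟨p,p'⟩, 0)`; i.e. the invariant Nomizu maps of the
`(D+1)`-dimensional carrollian homogeneous spacetimes form exactly the one-parameter
family `α(P_a,P_b) = ζ δ_{ab} H`, all other components vanishing. -/
theorem carrollian_nomizu_maps (D : ℕ) (hD : 3 ≤ D)
    (α : Mspace D →ₗ[ℝ] Mspace D →ₗ[ℝ] Mspace D) :
    ((∀ Λ : Matrix (Fin D) (Fin D) ℝ, Λᵀ = -Λ → IsEquivariant (rotMap Λ) α) ∧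
      (∀ a : Fin D, IsEquivariant (carBoost a) α))
    ↔ ∃ ζ : ℝ, ∀ v w : Mspace D,
        α v w = ((ζ * (v.2 ⬝ᵥ w.2), 0) : Mspace D) := by
  constructor
  · rintro ⟨hrot, hboost⟩
    have other : ∀ b c : Fin D, ∃ k, k ≠ b ∧ k ≠ c := by
      intro b c
      obtain ⟨k, hk⟩ : ∃ k, k ∉ ({b, c} : Finset (Fin D)) := by
        by_contra! h
        have h1 := Finset.card_le_card (fun x _ => h x : Finset.univ ⊆ ({b, c} : Finset (Fin D)))
        have h2 : ({b, c} : Finset (Fin D)).card ≤ 2 := Finset.card_le_two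
        rw [Finset.card_univ, Fintype.card_fin] at h1
        omega
      exact ⟨k, by simpa using hk⟩
    have boost : ∀ a h p h' p', ((α (h, p) (h', p')).2 a, (0 : Fin D → ℝ)) =
        α (p a, 0) (h', p') + α (h, p) (p' a, 0) := by
      intro a h p h' p'
      have := hboost a (h, p) (h', p')
      rw [carBoost_apply a h p, carBoost_apply a h' p'] at this
      rw [← this]
      exact (carBoost_apply a _ _).symm
    have rot : ∀ i j h p h' p',
        α (0, Pi.single i (p j) - Pi.single j (p i)) (h', p') +
          α (h, p) (0, Pi.single i (p' j) - Pi.single j (p' i)) =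
        (0, planeRotation i j *ᵥ (α (h, p) (h', p')).2) := by
      intro i j h p h' p'
      have := hrot _ (planeRotation_transpose i j) (h, p) (h', p')
      rw [rotMap_apply _ (α _ _), rotMap_planeRotation, rotMap_planeRotation] at this
      exact this.symm
    have zero : ((0, 0) : Mspace D) = 0 := rfl
    have hHP2 : ∀ c, (α (1, 0) (0, Pi.single c 1)).2 = 0 := by
      intro c
      obtain ⟨a, hac, -⟩ := other c c
      have := congrArg Prod.snd (boost a 0 (Pi.single a 1) 0 (Pi.single c 1))
      simpa [hac, zero] using this.symm
    have hPH2 : ∀ c, (α (0, Pi.single c 1) (1, 0)).2 = 0 := by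
      intro c
      obtain ⟨a, hac, -⟩ := other c c
      have := congrArg Prod.snd (boost a 0 (Pi.single c 1) 0 (Pi.single a 1))
      simpa [hac, zero] using this.symm
    have hHP1 : ∀ c, (α (1, 0) (0, Pi.single c 1)).1 = 0 := by
      intro c
      obtain ⟨k, hk, -⟩ := other c c
      have := congrArg Prod.fst (rot c k 1 0 0 (Pi.single k 1))
      simpa [hk, hk.symm, zero] using this
    have hPH1 : ∀ c, (α (0, Pi.single c 1) (1, 0)).1 = 0 := by
      intro c
      obtain ⟨k, hk, -⟩ := other c c
      have := congrArg Prod.fst (rot c k 0 (Pi.single k 1) 1 0)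
      simpa [hk, hk.symm, zero] using this
    have hHP : ∀ c, α (1, 0) (0, Pi.single c 1) = 0 := fun c => Prod.ext (hHP1 c) (hHP2 c)
    have hPH : ∀ c, α (0, Pi.single c 1) (1, 0) = 0 := fun c => Prod.ext (hPH1 c) (hPH2 c)
    let o : Fin D := ⟨0, by omega⟩
    have hHH : α (1, 0) (1, 0) = 0 := by
      have := boost o 1 0 0 (Pi.single o 1)
      simpa [hHP, zero] using this.symm
    have hPP2 : ∀ b c, (α (0, Pi.single b 1) (0, Pi.single c 1)).2 = 0 := by
      intro b c
      ext a
      have := congrArg Prod.fst (boost a 0 (Pi.single b 1) 0 (Pi.single c 1))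
      by_cases hb : a = b <;> by_cases hc : a = c <;>
        simp_all [Pi.single_apply, Prod.mk_zero_zero]
    have hoff : ∀ b c, b ≠ c → (α (0, Pi.single b 1) (0, Pi.single c 1)).1 = 0 := by
      intro b c hbc
      obtain ⟨k, hkb, hkc⟩ := other b c
      have := congrArg Prod.fst (rot b k 0 (Pi.single k 1) 0 (Pi.single c 1))
      simpa [hkb, hkb.symm, hkc, hbc, zero] using this
    have hdiag : ∀ b c, (α (0, Pi.single b 1) (0, Pi.single b 1)).1 =
        (α (0, Pi.single c 1) (0, Pi.single c 1)).1 := by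
      intro b c
      by_cases hbc : b = c
      · rw [hbc]
      have := congrArg Prod.fst (rot b c 0 (Pi.single c 1) 0 (Pi.single b 1))
      have neg : ((0, -Pi.single c 1) : Mspace D) = (-1 : ℝ) • (0, Pi.single c 1) := by simp
      simp only [Pi.single_eq_same, Pi.single_eq_of_ne hbc, Pi.single_eq_of_ne (Ne.symm hbc),
        Pi.single_zero, sub_zero, zero_sub, neg, map_smul, Prod.fst_add, Prod.smul_fst,
        smul_eq_mul] at this
      linarith
    refine ⟨(α (0, Pi.single o 1) (0, Pi.single o 1)).1,
      bilin_eq_of_basis α _ hHH hHP hPH fun b c => Prod.ext ?_ (hPP2 b c)⟩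
    by_cases hbc : b = c
    · subst hbc
      simpa using hdiag b o
    · simpa [hbc] using hoff b c hbc
  · rintro ⟨ζ, hα⟩
    refine ⟨fun Λ hΛ Y Z => ?_, fun a Y Z => ?_⟩
    · have key : (Λ *ᵥ Y.2) ⬝ᵥ Z.2 = -(Y.2 ⬝ᵥ (Λ *ᵥ Z.2)) := by
        rw [dotProduct_mulVec, ← mulVec_transpose, hΛ, neg_mulVec, neg_dotProduct, neg_neg]
      simp [hα, rotMap_apply, key]
    · obtain ⟨h, p⟩ := Y
      obtain ⟨h', p'⟩ := Z
      simp [hα, carBoost_apply]
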